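/- Let p, r, q be points with r and q in a cone of apex p of angular width θ = π/3, let α = ∠(rpq) < π/3, and suppose in the Delaunay triangulation DT(P) of a point set P in general position there is no point of P inside triangle (p, r, q). Then there is a path from r to q in DT(P), using only edges between consecutive neighbours of p, whose total length is at most (α / sin α) · |rq|. -/

import Mathlib

open Real EuclideanGeometry

/-- (u,v) is a Delaunay edge of the point set P: some disk with u and v on its boundary
contains no other point of P. -/
def DelaunayEdge (P : Finset (EuclideanSpace ℝ (Fin 2)))
    (u v : EuclideanSpace ℝ (Fin 2)) : Prop :=
  ∃ (c : EuclideanSpace ℝ (Fin 2)) (ρ : ℝ),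
    dist c u = ρ ∧ dist c v = ρ ∧ ∀ t ∈ P, t ≠ u → t ≠ v → ρ < dist c t

/-- General position: no three points of P are collinear and no four are concyclic. -/
def GenPos (P : Finset (EuclideanSpace ℝ (Fin 2))) : Prop :=
  (∀ a ∈ P, ∀ b ∈ P, ∀ c ∈ P, a ≠ b → a ≠ c → b ≠ c →
    ¬ Collinear ℝ ({a, b, c} : Set (EuclideanSpace ℝ (Fin 2)))) ∧
  (∀ a ∈ P, ∀ b ∈ P, ∀ c ∈ P, ∀ d ∈ P,
    a ≠ b → a ≠ c → a ≠ d → b ≠ c → b ≠ d → c ≠ d →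
    ¬ ∃ (o : EuclideanSpace ℝ (Fin 2)) (ρ : ℝ),
      dist o a = ρ ∧ dist o b = ρ ∧ dist o c = ρ ∧ dist o d = ρ)

/-- The signed area of the parallelogram spanned by two plane vectors. -/
def cross (v w : EuclideanSpace ℝ (Fin 2)) : ℝ := v 0 * w 1 - v 1 * w 0

/-- The power of the point `v` with respect to the circle through the origin with centre `c`. -/
noncomputable def circlePower (c v : EuclideanSpace ℝ (Fin 2)) : ℝ := ‖v‖ ^ 2 - 2 * inner ℝ c v

lemma cross_comm (v w : EuclideanSpace ℝ (Fin 2)) : cross v w = -cross w v := by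
  simp only [cross]; ring

lemma cross_combination_right (R Q : EuclideanSpace ℝ (Fin 2)) (x y : ℝ) :
    cross R (x • R + y • Q) = y * cross R Q := by
  simp [cross]; ring

lemma cross_combination_left (R Q : EuclideanSpace ℝ (Fin 2)) (x y : ℝ) :
    cross (x • R + y • Q) Q = x * cross R Q := by
  simp [cross]; ring

lemma exists_combination {R Q : EuclideanSpace ℝ (Fin 2)} (h : cross R Q ≠ 0)
    (v : EuclideanSpace ℝ (Fin 2)) : ∃ x y : ℝ, v = x • R + y • Q := by
  refine ⟨cross v Q / cross R Q, cross R v / cross R Q, ?_⟩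
  ext i
  have key : cross R Q * v i = cross v Q * R i + cross R v * Q i := by
    fin_cases i <;> simp [cross] <;> ring
  simp only [PiLp.add_apply, PiLp.smul_apply, smul_eq_mul]
  field_simp
  linarith

lemma combination_injective {R Q : EuclideanSpace ℝ (Fin 2)} (h : cross R Q ≠ 0)
    {x y x' y' : ℝ} (he : x • R + y • Q = x' • R + y' • Q) : x = x' ∧ y = y' := by
  constructor
  · have := congrArg (fun v => cross v Q) he
    simp only [cross_combination_left] at this
    exact mul_right_cancel₀ h this
  · have := congrArg (cross R) he
    simp only [cross_combination_right] at this
    exact mul_right_cancel₀ h this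

lemma exists_inner_eq {R Q : EuclideanSpace ℝ (Fin 2)} (h : cross R Q ≠ 0) (a b : ℝ) :
    ∃ w : EuclideanSpace ℝ (Fin 2), inner ℝ w R = a ∧ inner ℝ w Q = b := by
  refine ⟨!₂[(a * Q 1 - b * R 1) / cross R Q, (b * R 0 - a * Q 0) / cross R Q], ?_, ?_⟩ <;>
  · simp [PiLp.inner_apply, Fin.sum_univ_two]
    field_simp
    simp only [cross]
    ring

lemma circlePower_combination (c R Q : EuclideanSpace ℝ (Fin 2)) (x y : ℝ) :
    circlePower c (x • R + y • Q) =
      ‖x • R + y • Q‖ ^ 2 - 2 * (x * inner ℝ c R + y * inner ℝ c Q) := by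
  simp only [circlePower, inner_add_right, inner_smul_right]

lemma circlePower_sub_center (c d v : EuclideanSpace ℝ (Fin 2)) :
    circlePower (c - d) v = circlePower c v + 2 * inner ℝ d v := by
  simp only [circlePower, inner_sub_left]; ring

lemma circlePower_sub_sub (c a v : EuclideanSpace ℝ (Fin 2)) :
    circlePower (c - a) (v - a) = circlePower c v - circlePower c a := by
  simp only [circlePower, norm_sub_sq_real, inner_sub_left, inner_sub_right,
    real_inner_self_eq_norm_sq, real_inner_comm v a]
  ring

/-- A disk whose boundary circle passes through the origin is convex. -/
lemma circlePower_combination_nonpos {c R Q : EuclideanSpace ℝ (Fin 2)} {x y : ℝ}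
    (hx : 0 ≤ x) (hy : 0 ≤ y) (hxy : x + y ≤ 1) (hR : circlePower c R ≤ 0)
    (hQ : circlePower c Q ≤ 0) : circlePower c (x • R + y • Q) ≤ 0 := by
  rw [circlePower_combination]
  have e1 : ‖x • R + y • Q‖ ^ 2 = x ^ 2 * ‖R‖ ^ 2 + y ^ 2 * ‖Q‖ ^ 2 + 2 * x * y * inner ℝ R Q := by
    rw [norm_add_sq_real, norm_smul, norm_smul, inner_smul_left, inner_smul_right, mul_pow,
      mul_pow]
    simp; ring
  have e2 : 0 ≤ ‖R‖ ^ 2 + ‖Q‖ ^ 2 - 2 * inner ℝ R Q := by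
    have := norm_sub_sq_real R Q
    nlinarith [sq_nonneg ‖R - Q‖]
  rw [e1]
  unfold circlePower at hR hQ
  have h1 := mul_nonneg (mul_nonneg hx hy) e2
  have h2 := mul_nonneg hx (sub_nonneg.2 hR)
  have h3 := mul_nonneg hy (sub_nonneg.2 hQ)
  have h4 := mul_nonneg (sub_nonneg.2 hxy)
    (add_nonneg (mul_nonneg hx (sq_nonneg ‖R‖)) (mul_nonneg hy (sq_nonneg ‖Q‖)))
  nlinarith

lemma dist_add_sq (p c t : EuclideanSpace ℝ (Fin 2)) :
    dist (p + c) t ^ 2 = ‖c‖ ^ 2 + circlePower c (t - p) := by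
  have : p + c - t = c - (t - p) := by abel
  rw [dist_eq_norm, this, norm_sub_sq_real, circlePower]
  ring

lemma dist_add_eq_iff (p c t : EuclideanSpace ℝ (Fin 2)) :
    dist (p + c) t = ‖c‖ ↔ circlePower c (t - p) = 0 := by
  rw [← sq_eq_sq₀ dist_nonneg (norm_nonneg c), dist_add_sq]
  constructor <;> intro h <;> linarith

lemma lt_dist_add_iff (p c t : EuclideanSpace ℝ (Fin 2)) :
    ‖c‖ < dist (p + c) t ↔ 0 < circlePower c (t - p) := by
  rw [← sq_lt_sq₀ (norm_nonneg c) dist_nonneg, dist_add_sq]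
  constructor <;> intro h <;> linarith

lemma delaunayEdge_iff_circlePower {P : Finset (EuclideanSpace ℝ (Fin 2))}
    {p s : EuclideanSpace ℝ (Fin 2)} :
    DelaunayEdge P p s ↔ ∃ c : EuclideanSpace ℝ (Fin 2), circlePower c (s - p) = 0 ∧
      ∀ t ∈ P, t ≠ p → t ≠ s → 0 < circlePower c (t - p) := by
  constructor
  · rintro ⟨c, ρ, hp, hs, ht⟩
    have hc : p + (c - p) = c := by abel
    have hρ : ‖c - p‖ = ρ := by rw [← dist_eq_norm, hp]
    refine ⟨c - p, ?_, fun t h1 h2 h3 => ?_⟩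
    · rw [← dist_add_eq_iff, hc, hs, hρ]
    · rw [← lt_dist_add_iff, hc, hρ]
      exact ht t h1 h2 h3
  · rintro ⟨c, hs, ht⟩
    refine ⟨p + c, ‖c‖, by simp [dist_eq_norm], (dist_add_eq_iff _ _ _).2 hs,
      fun t h1 h2 h3 => (lt_dist_add_iff _ _ _).2 (ht t h1 h2 h3)⟩

/-- An edge of a triangle whose closed circumdisk contains no further point is Delaunay. -/
lemma delaunayEdge_of_empty_circumdisk {P : Finset (EuclideanSpace ℝ (Fin 2))}
    {u v w c : EuclideanSpace ℝ (Fin 2)} (hvw : cross (v - u) (w - u) ≠ 0)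
    (hv : circlePower c (v - u) = 0) (hw : circlePower c (w - u) = 0)
    (h : ∀ t ∈ P, t ≠ u → t ≠ v → t ≠ w → 0 < circlePower c (t - u)) :
    DelaunayEdge P u v := by
  obtain ⟨n, hnv, hnw⟩ := exists_inner_eq hvw 0 1
  have key : ∀ t ∈ P, ∀ᶠ ε in nhdsWithin (0 : ℝ) (Set.Ioi 0),
      t ≠ u → t ≠ v → 0 < circlePower (c - ε • n) (t - u) := by
    intro t ht
    by_cases htw : t = w
    · filter_upwards [self_mem_nhdsWithin] with ε hε _ _
      rw [htw, circlePower_sub_center, hw, inner_smul_left, hnw]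
      have : 0 < ε := hε
      simpa using this
    · by_cases htu : t = u
      · simp [htu]
      by_cases htv : t = v
      · simp [htv]
      have hcont : Continuous fun ε : ℝ => circlePower (c - ε • n) (t - u) := by
        simp only [circlePower]
        fun_prop
      have h0 : 0 < circlePower (c - (0 : ℝ) • n) (t - u) := by
        simpa using h t ht htu htv htw
      filter_upwards [(hcont.continuousAt.eventually (lt_mem_nhds h0)).filter_mono
        nhdsWithin_le_nhds] with ε hε _ _ using hε
  obtain ⟨ε, hε⟩ := ((Filter.eventually_all_finset P).2 key).exists
  refine delaunayEdge_iff_circlePower.2 ⟨c - ε • n, ?_, fun t h1 h2 h3 => hε t h1 h2 h3⟩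
  rw [circlePower_sub_center, hv, inner_smul_left, hnv]
  simp

/-- Two circles through the origin and `R` differ in power by a linear functional vanishing
on `R`. -/
lemma circlePower_pencil {c d R : EuclideanSpace ℝ (Fin 2)} (hc : circlePower c R = 0)
    (hd : circlePower d R = 0) (Q : EuclideanSpace ℝ (Fin 2)) (x y : ℝ) :
    circlePower d (x • R + y • Q) =
      circlePower c (x • R + y • Q) + y * (circlePower d Q - circlePower c Q) := by
  simp only [circlePower_combination]
  simp only [circlePower] at *
  linear_combination -x * hc + x * hd

lemma exists_circumcenter {R Q : EuclideanSpace ℝ (Fin 2)} (h : cross R Q ≠ 0) (b : ℝ) :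
    ∃ c, circlePower c R = 0 ∧ circlePower c Q = b := by
  obtain ⟨c, h1, h2⟩ := exists_inner_eq h (‖R‖ ^ 2 / 2) ((‖Q‖ ^ 2 - b) / 2)
  refine ⟨c, ?_, ?_⟩
  · rw [circlePower, h1]; ring
  · rw [circlePower, h2]; ring

lemma ne_of_cross_ne_zero {p r q : EuclideanSpace ℝ (Fin 2)} (h : cross (r - p) (q - p) ≠ 0) :
    r ≠ p ∧ q ≠ p ∧ r ≠ q := by
  refine ⟨?_, ?_, ?_⟩ <;> rintro rfl <;> apply h <;> (simp [cross]; try ring)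

lemma GenPos.circlePower_ne_zero {P : Finset (EuclideanSpace ℝ (Fin 2))} (hP : GenPos P)
    {p a b d c : EuclideanSpace ℝ (Fin 2)} (hp : p ∈ P) (ha : a ∈ P) (hb : b ∈ P) (hd : d ∈ P)
    (hap : a ≠ p) (hbp : b ≠ p) (hdp : d ≠ p) (hab : a ≠ b) (had : a ≠ d) (hbd : b ≠ d)
    (hca : circlePower c (a - p) = 0) (hcb : circlePower c (b - p) = 0) :
    circlePower c (d - p) ≠ 0 := fun hcd =>
  hP.2 p hp a ha b hb d hd hap.symm hbp.symm hdp.symm hab had hbd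
    ⟨p + c, ‖c‖, by simp [dist_eq_norm], (dist_add_eq_iff _ _ _).2 hca,
      (dist_add_eq_iff _ _ _).2 hcb, (dist_add_eq_iff _ _ _).2 hcd⟩

/-- A point of `P` in the circumdisk of `p`, `r`, `q`, where `pr` is Delaunay, lies on the same
side of `pr` as `q`. -/
lemma coord_pos_of_circlePower_nonpos {P : Finset (EuclideanSpace ℝ (Fin 2))}
    {p r q c t : EuclideanSpace ℝ (Fin 2)} (hq : q ∈ P) (hqp : q ≠ p) (hqr : q ≠ r)
    (hpr : DelaunayEdge P p r)
    (hcr : circlePower c (r - p) = 0) (hcq : circlePower c (q - p) = 0)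
    (ht : t ∈ P) (htp : t ≠ p) (htr : t ≠ r) (hct : circlePower c (t - p) ≤ 0)
    {x y : ℝ} (hxy : t - p = x • (r - p) + y • (q - p)) : 0 < y := by
  obtain ⟨d, hdr, hd⟩ := delaunayEdge_iff_circlePower.1 hpr
  have h1 := hd t ht htp htr
  have h2 := hd q hq hqp hqr
  rw [hxy] at hct h1
  rw [circlePower_pencil hcr hdr, hcq, sub_zero] at h1
  exact pos_of_mul_pos_left (by linarith : 0 < y * circlePower d (q - p)) h2.le

/-- If the circumdisk of `p`, `r`, `q` contains a further point of `P`, then it contains a further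
Delaunay neighbour of `p`. -/
lemma exists_neighbor_in_circumdisk {P : Finset (EuclideanSpace ℝ (Fin 2))} (hP : GenPos P)
    {p r q c : EuclideanSpace ℝ (Fin 2)} (hp : p ∈ P) (hr : r ∈ P) (hq : q ∈ P)
    (hrq : cross (r - p) (q - p) ≠ 0) (hpr : DelaunayEdge P p r)
    (hcr : circlePower c (r - p) = 0) (hcq : circlePower c (q - p) = 0)
    (hne : ∃ t ∈ P, t ≠ p ∧ t ≠ r ∧ t ≠ q ∧ circlePower c (t - p) ≤ 0) :
    ∃ a ∈ P, a ≠ p ∧ a ≠ r ∧ a ≠ q ∧ circlePower c (a - p) ≤ 0 ∧ DelaunayEdge P p a := by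
  classical
  obtain ⟨hrp, hqp, hr_ne_q⟩ := ne_of_cross_ne_zero hrq
  choose x y hxy using fun t => exists_combination hrq (t - p)
  have hy : ∀ t ∈ P, t ≠ p → t ≠ r → circlePower c (t - p) ≤ 0 → 0 < y t :=
    fun t ht h1 h2 h3 =>
      coord_pos_of_circlePower_nonpos hq hqp hr_ne_q.symm hpr hcr hcq ht h1 h2 h3 (hxy t)
  have hmem : ∀ t, t ∈ {t ∈ P | t ≠ p ∧ t ≠ r ∧ t ≠ q ∧ circlePower c (t - p) ≤ 0} ↔
    t ∈ P ∧ t ≠ p ∧ t ≠ r ∧ t ≠ q ∧ circlePower c (t - p) ≤ 0 := fun t => Finset.mem_filter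
  obtain ⟨a, ha, hmin⟩ := Finset.exists_min_image
    {t ∈ P | t ≠ p ∧ t ≠ r ∧ t ≠ q ∧ circlePower c (t - p) ≤ 0}
    (fun t => circlePower c (t - p) / y t)
    (by obtain ⟨t, ht⟩ := hne; exact ⟨t, (hmem t).2 ht⟩)
  obtain ⟨haP, hap, har, haq, hca⟩ := (hmem a).1 ha
  have hya := hy a haP hap har hca
  have hca' : circlePower c (a - p) < 0 := hca.lt_of_ne
    (hP.circlePower_ne_zero hp hr hq haP hrp hqp hap hr_ne_q har.symm haq.symm hcr hcq)
  obtain ⟨m, hm⟩ : ∃ m, m = circlePower c (a - p) / y a := ⟨_, rfl⟩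
  have hm0 : m < 0 := hm ▸ div_neg_of_neg_of_pos hca' hya
  have hma : circlePower c (a - p) = y a * m := by rw [hm]; field_simp
  obtain ⟨d, hdr, hdq⟩ := exists_circumcenter hrq (-m)
  have hdt : ∀ t, circlePower d (t - p) = circlePower c (t - p) - y t * m := by
    intro t
    rw [hxy t, circlePower_pencil hcr hdr, hcq, hdq]
    ring
  have hda : circlePower d (a - p) = 0 := by rw [hdt, hma]; ring
  have hcross : cross (a - p) (r - p) ≠ 0 := by
    rw [cross_comm, hxy a, cross_combination_right]
    exact neg_ne_zero.2 (mul_ne_zero hya.ne' hrq)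
  refine ⟨a, haP, hap, har, haq, hca,
    delaunayEdge_of_empty_circumdisk hcross hda hdr fun t ht htp hta htr => ?_⟩
  by_cases htq : t = q
  · rw [htq, hdq]; linarith
  rcases le_or_gt (circlePower c (t - p)) 0 with hct | hct
  · have h1 := hmin t ((hmem t).2 ⟨ht, htp, htr, htq, hct⟩)
    have h2 := hy t ht htp htr hct
    rw [← hm, le_div_iff₀ h2] at h1
    refine lt_of_le_of_ne (by rw [hdt]; linarith) (Ne.symm ?_)
    exact hP.circlePower_ne_zero hp hr haP ht hrp hap htp har.symm htr.symm hta.symm hdr hda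
  · rw [hdt]
    rcases le_or_gt 0 (y t) with hyt | hyt
    · nlinarith
    · obtain ⟨e, her, he⟩ := delaunayEdge_iff_circlePower.1 hpr
      have h1 := he t ht htp htr
      have h2 := he a haP hap har
      rw [hxy t, circlePower_pencil hcr her, ← hxy t, hcq, sub_zero] at h1
      rw [hxy a, circlePower_pencil hcr her, ← hxy a, hcq, sub_zero, hma, ← mul_add] at h2
      have h3 := pos_of_mul_pos_right h2 hya.le
      nlinarith

lemma delaunayEdge_of_circumdisk_empty_at {P : Finset (EuclideanSpace ℝ (Fin 2))}
    {p r q c : EuclideanSpace ℝ (Fin 2)} (hrq : cross (r - p) (q - p) ≠ 0)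
    (hcr : circlePower c (r - p) = 0) (hcq : circlePower c (q - p) = 0)
    (h : ∀ t ∈ P, t ≠ p → t ≠ r → t ≠ q → 0 < circlePower c (t - p)) :
    DelaunayEdge P r q := by
  have hshift : ∀ t, circlePower (c - (r - p)) (t - r) = circlePower c (t - p) := by
    intro t
    rw [← sub_sub_sub_cancel_right t r p, circlePower_sub_sub, hcr, sub_zero]
  refine delaunayEdge_of_empty_circumdisk (w := p) (c := c - (r - p)) ?_ ?_ ?_ ?_
  · have : cross (q - r) (p - r) = cross (r - p) (q - p) := by simp [cross]; ring
    rwa [this]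
  · rw [hshift, hcq]
  · rw [hshift]; simp [circlePower]
  · intro t ht h1 h2 h3
    rw [hshift]
    exact h t ht h3 h1 h2

/-- The second intersection point `Y` of the circumcircle of `0`, `R`, `Q` with the ray through
`a` satisfies the law of sines for the chord `RY`. -/
lemma norm_chord {V : Type*} [NormedAddCommGroup V] [InnerProductSpace ℝ V] {R Q a : V} {x y : ℝ}
    (ha : a = x • R + y • Q) (hy : 0 ≤ y) (ha0 : a ≠ 0) :
    ‖R - ((x * ‖R‖ ^ 2 + y * ‖Q‖ ^ 2) / ‖a‖ ^ 2) • a‖ * ‖a‖ = y * ‖Q‖ * ‖R - Q‖ := by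
  have hpos : 0 < ‖a‖ ^ 2 := by positivity
  rw [← sq_eq_sq₀ (by positivity) (by positivity), mul_pow, norm_sub_sq_real, norm_smul,
    inner_smul_right, mul_pow, mul_pow, norm_sub_sq_real, Real.norm_eq_abs, sq_abs]
  have e1 : ‖a‖ ^ 2 = x ^ 2 * ‖R‖ ^ 2 + y ^ 2 * ‖Q‖ ^ 2 + 2 * x * y * inner ℝ R Q := by
    rw [ha, norm_add_sq_real, norm_smul, norm_smul, inner_smul_left, inner_smul_right, mul_pow,
      mul_pow]
    simp; ring
  have e2 : inner ℝ R a = x * ‖R‖ ^ 2 + y * inner ℝ R Q := by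
    rw [ha, inner_add_right, inner_smul_right, inner_smul_right, real_inner_self_eq_norm_sq]
  rw [e2]
  field_simp
  rw [e1]
  ring

lemma norm_mul_sin_angle_combination {V : Type*} [NormedAddCommGroup V] [InnerProductSpace ℝ V]
    {R Q a : V} {x y : ℝ} (ha : a = x • R + y • Q) (hy : 0 ≤ y) (hR : R ≠ 0) :
    ‖a‖ * Real.sin (InnerProductGeometry.angle R a) =
      y * ‖Q‖ * Real.sin (InnerProductGeometry.angle R Q) := by
  have h1 := InnerProductGeometry.sin_angle_mul_norm_mul_norm R a
  have h2 := InnerProductGeometry.sin_angle_mul_norm_mul_norm R Q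
  have e : inner ℝ R R * inner ℝ a a - inner ℝ R a * inner ℝ R a =
      y ^ 2 * (inner ℝ R R * inner ℝ Q Q - inner ℝ R Q * inner ℝ R Q) := by
    simp only [ha, inner_add_right, inner_add_left, inner_smul_right, inner_smul_left,
      real_inner_comm R Q]
    simp; ring
  rw [e, Real.sqrt_mul (sq_nonneg y), Real.sqrt_sq hy, ← h2] at h1
  have hR' : ‖R‖ ≠ 0 := norm_ne_zero_iff.2 hR
  apply mul_left_cancel₀ hR'
  linarith

lemma mul_sin_le_mul_sin {a b : ℝ} (ha : 0 ≤ a) (hab : a ≤ b) (hb : b ≤ π) :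
    a * Real.sin b ≤ b * Real.sin a := by
  rcases (ha.trans hab).eq_or_lt with h | h
  · rw [← h] at hab ⊢
    simp [le_antisymm hab ha]
  have h1 := strictConcaveOn_sin_Icc.concaveOn.2
    (show (0 : ℝ) ∈ Set.Icc 0 π from ⟨le_rfl, pi_pos.le⟩) (show b ∈ Set.Icc 0 π from ⟨h.le, hb⟩)
    (show 0 ≤ 1 - a / b by rw [sub_nonneg, div_le_one h]; exact hab)
    (show 0 ≤ a / b by positivity) (by ring)
  simp only [smul_eq_mul, Real.sin_zero, mul_zero, zero_add] at h1
  rw [div_mul_cancel₀ _ h.ne', div_mul_eq_mul_div, div_le_iff₀ h] at h1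
  linarith

/-- If `a` lies in the cone spanned by `R` and `Q`, beyond the line `RQ` but inside the
circumcircle of `0`, `R`, `Q`, then the two circular arcs over `Ra` and `aQ` are together no longer
than the arc over `RQ`. -/
lemma arc_add_arc_le {V : Type*} [NormedAddCommGroup V] [InnerProductSpace ℝ V]
    {R Q a : V} {x y : ℝ} (ha : a = x • R + y • Q) (hx : 0 < x) (hy : 0 < y) (hxy : 1 ≤ x + y)
    (hR : R ≠ 0) (hQ : Q ≠ 0) (hcirc : ‖a‖ ^ 2 ≤ x * ‖R‖ ^ 2 + y * ‖Q‖ ^ 2)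
    (hsin : 0 < Real.sin (InnerProductGeometry.angle R Q)) :
    InnerProductGeometry.angle R a / Real.sin (InnerProductGeometry.angle R a) * ‖R - a‖ +
      InnerProductGeometry.angle a Q / Real.sin (InnerProductGeometry.angle a Q) * ‖a - Q‖ ≤
      InnerProductGeometry.angle R Q / Real.sin (InnerProductGeometry.angle R Q) * ‖R - Q‖ := by
  have ha' : a = y • Q + x • R := by rw [ha, add_comm]
  have hs1 := norm_mul_sin_angle_combination ha hy.le hR
  have hs2 := norm_mul_sin_angle_combination ha' hx.le hQ
  rw [InnerProductGeometry.angle_comm Q a, InnerProductGeometry.angle_comm Q R] at hs2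
  have hRn : 0 < ‖R‖ := norm_pos_iff.2 hR
  have hQn : 0 < ‖Q‖ := norm_pos_iff.2 hQ
  have han : 0 < ‖a‖ := by
    refine norm_pos_iff.2 fun h0 => ?_
    rw [h0, norm_zero, zero_mul] at hs1
    exact (mul_pos (mul_pos hy hQn) hsin).ne hs1
  have hc1 := norm_chord ha hy.le (norm_pos_iff.1 han)
  have hc2 := norm_chord ha' hx.le (norm_pos_iff.1 han)
  rw [norm_sub_rev Q R, norm_sub_rev Q, add_comm (y * _)] at hc2
  have hadd : InnerProductGeometry.angle R Q =
      InnerProductGeometry.angle R a + InnerProductGeometry.angle a Q := by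
    have := InnerProductGeometry.angle_eq_angle_add_add_angle_add (x • R) (smul_ne_zero hy.ne' hQ)
    rwa [← ha, InnerProductGeometry.angle_smul_left_of_pos _ _ hx,
      InnerProductGeometry.angle_smul_left_of_pos _ _ hx,
      InnerProductGeometry.angle_smul_right_of_pos _ _ hy,
      InnerProductGeometry.angle_smul_left_of_pos _ _ hy,
      InnerProductGeometry.angle_comm Q a] at this
  have h10 := InnerProductGeometry.angle_nonneg R a
  have h20 := InnerProductGeometry.angle_nonneg a Q
  have hπ := InnerProductGeometry.angle_le_pi R Q
  obtain ⟨s, hs⟩ : ∃ s, s = (x + y)⁻¹ := ⟨_, rfl⟩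
  obtain ⟨s', hs'⟩ : ∃ s', s' = (x * ‖R‖ ^ 2 + y * ‖Q‖ ^ 2) / ‖a‖ ^ 2 := ⟨_, rfl⟩
  rw [← hs'] at hc1 hc2
  have hsle : s ≤ 1 := hs ▸ inv_le_one_of_one_le₀ hxy
  have hs'ge : 1 ≤ s' := by rw [hs', le_div_iff₀ (by positivity)]; linarith
  have hsxy : s * (x + y) = 1 := by rw [hs]; field_simp
  have hspos : 0 < s := by rw [hs]; positivity
  have hd1 : ‖R - s • a‖ = s * y * ‖R - Q‖ := by
    have : R - s • a = (s * y) • (R - Q) := by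
      have e : R = (s * (x + y)) • R := by rw [hsxy, one_smul]
      rw [ha]
      nth_rewrite 1 [e]
      module
    rw [this, norm_smul, Real.norm_of_nonneg (by positivity)]
  have hd2 : ‖s • a - Q‖ = s * x * ‖R - Q‖ := by
    have : s • a - Q = (s * x) • (R - Q) := by
      have e : Q = (s * (x + y)) • Q := by rw [hsxy, one_smul]
      rw [ha]
      nth_rewrite 2 [e]
      module
    rw [this, norm_smul, Real.norm_of_nonneg (by positivity)]
  obtain ⟨u, v, hu, hv, huv, huv1⟩ : (1 : ℝ) ∈ segment ℝ s s' := by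
    rw [segment_eq_Icc (hsle.trans hs'ge)]; exact ⟨hsle, hs'ge⟩
  simp only [smul_eq_mul] at huv1
  have hb1 : ‖R - a‖ ≤ u * ‖R - s • a‖ + v * ‖R - s' • a‖ := by
    have e : R - a = u • (R - s • a) + v • (R - s' • a) := by
      have e1 : R - a = (u + v) • R - (u * s + v * s') • a := by rw [huv, huv1, one_smul, one_smul]
      rw [e1]; module
    calc ‖R - a‖ ≤ ‖u • (R - s • a)‖ + ‖v • (R - s' • a)‖ := by rw [e]; exact norm_add_le _ _
      _ = _ := by
        rw [norm_smul, norm_smul, Real.norm_of_nonneg hu, Real.norm_of_nonneg hv]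
  have hb2 : ‖a - Q‖ ≤ u * ‖s • a - Q‖ + v * ‖s' • a - Q‖ := by
    have e : a - Q = u • (s • a - Q) + v • (s' • a - Q) := by
      have e1 : a - Q = (u * s + v * s') • a - (u + v) • Q := by rw [huv, huv1, one_smul, one_smul]
      rw [e1]; module
    calc ‖a - Q‖ ≤ ‖u • (s • a - Q)‖ + ‖v • (s' • a - Q)‖ := by rw [e]; exact norm_add_le _ _
      _ = _ := by
        rw [norm_smul, norm_smul, Real.norm_of_nonneg hu, Real.norm_of_nonneg hv]
  generalize InnerProductGeometry.angle R Q = α at *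
  generalize InnerProductGeometry.angle R a = α₁ at *
  generalize InnerProductGeometry.angle a Q = α₂ at *
  have hsin1 : 0 < Real.sin α₁ :=
    pos_of_mul_pos_right (hs1 ▸ mul_pos (mul_pos hy hQn) hsin) han.le
  have hsin2 : 0 < Real.sin α₂ :=
    pos_of_mul_pos_right (hs2 ▸ mul_pos (mul_pos hx hRn) hsin) han.le
  have hk1 : α₁ / Real.sin α₁ ≤ α / Real.sin α := by
    rw [div_le_div_iff₀ hsin1 hsin]
    exact mul_sin_le_mul_sin h10 (by linarith) hπ
  have hk2 : α₂ / Real.sin α₂ ≤ α / Real.sin α := by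
    rw [div_le_div_iff₀ hsin2 hsin]
    exact mul_sin_le_mul_sin h20 (by linarith) hπ
  have hy1 : α₁ / Real.sin α₁ * ‖R - s' • a‖ = α₁ / Real.sin α * ‖R - Q‖ := by
    have : ‖R - s' • a‖ * Real.sin α = Real.sin α₁ * ‖R - Q‖ := by
      apply mul_right_cancel₀ han.ne'
      linear_combination Real.sin α * hc1 - ‖R - Q‖ * hs1
    field_simp
    linear_combination α₁ * this
  have hy2 : α₂ / Real.sin α₂ * ‖s' • a - Q‖ = α₂ / Real.sin α * ‖R - Q‖ := by
    have : ‖s' • a - Q‖ * Real.sin α = Real.sin α₂ * ‖R - Q‖ := by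
      apply mul_right_cancel₀ han.ne'
      linear_combination Real.sin α * hc2 - ‖R - Q‖ * hs2
    field_simp
    linear_combination α₂ * this
  have hd : 0 ≤ ‖R - Q‖ := norm_nonneg _
  calc α₁ / Real.sin α₁ * ‖R - a‖ + α₂ / Real.sin α₂ * ‖a - Q‖
      ≤ α₁ / Real.sin α₁ * (u * ‖R - s • a‖ + v * ‖R - s' • a‖) +
        α₂ / Real.sin α₂ * (u * ‖s • a - Q‖ + v * ‖s' • a - Q‖) := by gcongr
    _ = u * (α₁ / Real.sin α₁ * ‖R - s • a‖) + u * (α₂ / Real.sin α₂ * ‖s • a - Q‖) +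
        v * (α₁ / Real.sin α * ‖R - Q‖) + v * (α₂ / Real.sin α * ‖R - Q‖) := by
      rw [← hy1, ← hy2]; ring
    _ ≤ u * (α / Real.sin α * ‖R - s • a‖) + u * (α / Real.sin α * ‖s • a - Q‖) +
        v * (α₁ / Real.sin α * ‖R - Q‖) + v * (α₂ / Real.sin α * ‖R - Q‖) := by gcongr
    _ = α / Real.sin α * ‖R - Q‖ := by
      rw [hd1, hd2]
      have hv' : v = 1 - u := by linarith
      rw [hv', hadd]
      linear_combination u * ((α₁ + α₂) / Real.sin (α₁ + α₂)) * ‖R - Q‖ * hsxy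

/-- There is a path from `r` to `q` of length at most `L` in the Delaunay triangulation of `P`,
all of whose vertices are Delaunay neighbours of `p`. -/
def HasCanonicalPath (P : Finset (EuclideanSpace ℝ (Fin 2)))
    (p r q : EuclideanSpace ℝ (Fin 2)) (L : ℝ) : Prop :=
  ∃ (n : ℕ) (f : ℕ → EuclideanSpace ℝ (Fin 2)),
    f 0 = r ∧ f n = q ∧
    (∀ i ≤ n, f i ∈ P ∧ DelaunayEdge P p (f i)) ∧
    (∀ i < n, DelaunayEdge P (f i) (f (i + 1))) ∧
    (∑ i ∈ Finset.range n, dist (f i) (f (i + 1))) ≤ L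

lemma HasCanonicalPath.of_edge {P : Finset (EuclideanSpace ℝ (Fin 2))}
    {p r q : EuclideanSpace ℝ (Fin 2)} {L : ℝ} (hr : r ∈ P) (hq : q ∈ P)
    (hpr : DelaunayEdge P p r) (hpq : DelaunayEdge P p q) (hrq : DelaunayEdge P r q)
    (hL : dist r q ≤ L) : HasCanonicalPath P p r q L := by
  refine ⟨1, fun i => if i = 0 then r else q, by simp, by simp, fun i _ => ?_, fun i hi => ?_,
    by simpa using hL⟩
  · by_cases h : i = 0 <;> simp [*]
  · obtain rfl : i = 0 := by lia
    simpa using hrq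

lemma HasCanonicalPath.trans {P : Finset (EuclideanSpace ℝ (Fin 2))}
    {p r a q : EuclideanSpace ℝ (Fin 2)} {L₁ L₂ : ℝ} (h₁ : HasCanonicalPath P p r a L₁)
    (h₂ : HasCanonicalPath P p a q L₂) : HasCanonicalPath P p r q (L₁ + L₂) := by
  obtain ⟨n, f, f0, fn, hf, hf', hfL⟩ := h₁
  obtain ⟨m, g, g0, gm, hg, hg', hgL⟩ := h₂
  obtain ⟨k, hk⟩ : ∃ k : ℕ → EuclideanSpace ℝ (Fin 2),
      k = fun i => if i ≤ n then f i else g (i - n) := ⟨_, rfl⟩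
  have hkf : ∀ i ≤ n, k i = f i := fun i hi => by simp [hk, hi]
  have hkg : ∀ i, k (n + i) = g i := by
    intro i
    rcases i.eq_zero_or_pos with rfl | hi
    · rw [add_zero, hkf n le_rfl, fn, g0]
    · have : ¬ n + i ≤ n := by lia
      simp [hk, hi.ne']
  refine ⟨n + m, k, by rw [hkf 0 n.zero_le, f0], by rw [hkg, gm], fun i hi => ?_, fun i hi => ?_, ?_⟩
  · rcases le_total i n with h | h
    · rw [hkf i h]; exact hf i h
    · obtain ⟨j, rfl⟩ := Nat.exists_eq_add_of_le h
      rw [hkg]; exact hg j (by lia)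
  · rcases lt_or_ge i n with h | h
    · rw [hkf i h.le, hkf (i + 1) h]; exact hf' i h
    · obtain ⟨j, rfl⟩ := Nat.exists_eq_add_of_le h
      rw [add_assoc, hkg, hkg]; exact hg' j (by lia)
  · rw [Finset.sum_range_add]
    refine add_le_add (le_of_eq_of_le (Finset.sum_congr rfl fun i hi => ?_) hfL)
      (le_of_eq_of_le (Finset.sum_congr rfl fun i hi => ?_) hgL)
    · have := Finset.mem_range.1 hi
      rw [hkf i this.le, hkf (i + 1) this]
    · rw [add_assoc, hkg, hkg]

lemma HasCanonicalPath.mono {P : Finset (EuclideanSpace ℝ (Fin 2))}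
    {p r q : EuclideanSpace ℝ (Fin 2)} {L L' : ℝ} (h : HasCanonicalPath P p r q L)
    (hL : L ≤ L') : HasCanonicalPath P p r q L' := by
  obtain ⟨n, f, h1, h2, h3, h4, h5⟩ := h
  exact ⟨n, f, h1, h2, h3, h4, h5.trans hL⟩

/-- The triangle `p`, `r`, `q` contains no further Delaunay neighbour of `p`. -/
def NeighborFreeTriangle (P : Finset (EuclideanSpace ℝ (Fin 2)))
    (p r q : EuclideanSpace ℝ (Fin 2)) : Prop :=
  ∀ t ∈ P, DelaunayEdge P p t → t ≠ p → t ≠ r → t ≠ q →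
    ∀ x y : ℝ, 0 ≤ x → 0 ≤ y → x + y ≤ 1 → t - p ≠ x • (r - p) + y • (q - p)

lemma NeighborFreeTriangle.symm {P : Finset (EuclideanSpace ℝ (Fin 2))}
    {p r q : EuclideanSpace ℝ (Fin 2)} (h : NeighborFreeTriangle P p r q) :
    NeighborFreeTriangle P p q r := fun t ht htn htp htq htr x y hx hy hxy he =>
  h t ht htn htp htr htq y x hy hx (by linarith) (by rw [he, add_comm])

/-- Splitting a neighbour-free triangle at a neighbour `a` of `p` in the circumdisk that is closest
to the line `rq` leaves neighbour-free triangles. -/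
lemma NeighborFreeTriangle.split {P : Finset (EuclideanSpace ℝ (Fin 2))}
    {p r q a c : EuclideanSpace ℝ (Fin 2)} (h : NeighborFreeTriangle P p r q)
    (hrq : cross (r - p) (q - p) ≠ 0)
    (hcr : circlePower c (r - p) = 0) (hca : circlePower c (a - p) ≤ 0) {xa ya : ℝ}
    (ha : a - p = xa • (r - p) + ya • (q - p)) (hxa : 0 < xa) (hya : 0 < ya) (hxya : 1 < xa + ya)
    (hmin : ∀ t ∈ P, DelaunayEdge P p t → t ≠ p → t ≠ r → t ≠ q → circlePower c (t - p) ≤ 0 →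
      ∀ x y : ℝ, t - p = x • (r - p) + y • (q - p) → xa + ya ≤ x + y) :
    NeighborFreeTriangle P p r a := by
  intro t ht htn htp htr hta x y hx hy hxy he
  have he' : t - p = (x + y * xa) • (r - p) + (y * ya) • (q - p) := by rw [he, ha]; module
  have htq : t ≠ q := by
    rintro rfl
    have h1 : (0 : ℝ) • (r - p) + (1 : ℝ) • (t - p) =
        (x + y * xa) • (r - p) + (y * ya) • (t - p) := by
      rw [← he']; simp
    obtain ⟨h2, h3⟩ := combination_injective hrq h1
    have : y * xa = 0 := by nlinarith [mul_nonneg hy hxa.le]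
    rcases mul_eq_zero.1 this with h4 | h4
    · rw [h4] at h3; simp at h3
    · exact hxa.ne' h4
  have hct : circlePower c (t - p) ≤ 0 := by
    rw [he]; exact circlePower_combination_nonpos hx hy hxy hcr.le hca
  have h1 := hmin t ht htn htp htr htq hct _ _ he'
  have hx0 : x = 0 := by
    refine le_antisymm ?_ hx
    by_contra! hx'
    nlinarith [mul_pos hx' (sub_pos.2 hxya),
      mul_nonneg (sub_nonneg.2 hxy) (by linarith : 0 ≤ xa + ya)]
  have hy1 : y = 1 := by
    refine le_antisymm (by linarith) ?_
    by_contra! hy'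
    nlinarith [mul_pos (sub_pos.2 hy') (by linarith : 0 < xa + ya)]
  rw [hx0, hy1, zero_smul, zero_add, one_smul] at he
  exact hta (sub_left_injective he)

/-- The open cone with apex `p` spanned by `r` and `q`. -/
def openCone (p r q : EuclideanSpace ℝ (Fin 2)) : Set (EuclideanSpace ℝ (Fin 2)) :=
  {t | ∃ x y : ℝ, 0 < x ∧ 0 < y ∧ t - p = x • (r - p) + y • (q - p)}

lemma openCone_comm (p r q : EuclideanSpace ℝ (Fin 2)) : openCone p r q = openCone p q r := by
  ext t
  constructor <;> rintro ⟨x, y, hx, hy, h⟩ <;> exact ⟨y, x, hy, hx, by rw [h, add_comm]⟩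

lemma ncard_openCone_lt {P : Finset (EuclideanSpace ℝ (Fin 2))}
    {p r q a : EuclideanSpace ℝ (Fin 2)} (haP : a ∈ P) (hra : cross (r - p) (a - p) ≠ 0)
    (ha : a ∈ openCone p r q) :
    ((P : Set _) ∩ openCone p r a).ncard < ((P : Set _) ∩ openCone p r q).ncard := by
  refine Set.ncard_lt_ncard ?_ (P.finite_toSet.inter_of_left _)
  rw [Set.ssubset_iff_of_subset]
  · refine ⟨a, ⟨haP, ha⟩, fun hmem => ?_⟩
    obtain ⟨x, y, hx, hy, h⟩ := hmem.2
    have h1 : (0 : ℝ) • (r - p) + (1 : ℝ) • (a - p) = x • (r - p) + y • (a - p) := by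
      rw [← h]; simp
    exact hx.ne (combination_injective hra h1).1
  · obtain ⟨xa, ya, hxa, hya, ha⟩ := ha
    rintro t ⟨ht, x, y, hx, hy, h⟩
    refine ⟨ht, x + y * xa, y * ya, by positivity, by positivity, ?_⟩
    rw [h, ha]
    module

lemma sin_angle_pos_of_cross_ne_zero {R Q : EuclideanSpace ℝ (Fin 2)} (h : cross R Q ≠ 0) :
    0 < Real.sin (InnerProductGeometry.angle R Q) := by
  refine (InnerProductGeometry.sin_angle_nonneg R Q).lt_of_ne fun h0 => h ?_
  have h1 := InnerProductGeometry.sin_angle_mul_norm_mul_norm R Q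
  rw [← h0, zero_mul, eq_comm, Real.sqrt_eq_zero'] at h1
  simp only [PiLp.inner_apply, Fin.sum_univ_two, RCLike.inner_apply, conj_trivial] at h1
  refine pow_eq_zero_iff (two_ne_zero) |>.1 (le_antisymm ?_ (sq_nonneg _))
  simp only [cross]
  linarith

lemma cross_ne_zero_of_sin_angle_ne_zero {R Q : EuclideanSpace ℝ (Fin 2)}
    (h : Real.sin (InnerProductGeometry.angle R Q) ≠ 0) (hR : R ≠ 0) (hQ : Q ≠ 0) :
    cross R Q ≠ 0 := by
  intro h0
  have h1 := InnerProductGeometry.sin_angle_mul_norm_mul_norm R Q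
  have h2 : inner ℝ R R * inner ℝ Q Q - inner ℝ R Q * inner ℝ R Q = cross R Q ^ 2 := by
    simp only [PiLp.inner_apply, Fin.sum_univ_two, RCLike.inner_apply, conj_trivial, cross]
    ring
  rw [h2, h0] at h1
  simp [h, hR, hQ] at h1

/-- The path along Delaunay neighbours of `p` is no longer than the circular arc over `rq` of the
circumcircle of `p`, `r`, `q`. -/
lemma hasCanonicalPath_of_neighborFree {P : Finset (EuclideanSpace ℝ (Fin 2))} (hP : GenPos P)
    {p r q : EuclideanSpace ℝ (Fin 2)} (hp : p ∈ P) (hr : r ∈ P) (hq : q ∈ P)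
    (hrq : cross (r - p) (q - p) ≠ 0) (hpr : DelaunayEdge P p r) (hpq : DelaunayEdge P p q)
    (hfree : NeighborFreeTriangle P p r q) :
    HasCanonicalPath P p r q (∠ r p q / Real.sin (∠ r p q) * dist r q) := by
  classical
  induction hn : ((P : Set _) ∩ openCone p r q).ncard using Nat.strong_induction_on
    generalizing r q with
  | _ n ih =>
  obtain ⟨hrp, hqp, hr_ne_q⟩ := ne_of_cross_ne_zero hrq
  obtain ⟨c, hcr, hcq⟩ := exists_circumcenter hrq 0
  have hsin := sin_angle_pos_of_cross_ne_zero hrq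
  by_cases hS : ∃ t ∈ P, t ≠ p ∧ t ≠ r ∧ t ≠ q ∧ circlePower c (t - p) ≤ 0
  · choose x y hxy using fun t => exists_combination hrq (t - p)
    obtain ⟨a, ha, hmin⟩ := Finset.exists_min_image
      {t ∈ P | t ≠ p ∧ t ≠ r ∧ t ≠ q ∧ circlePower c (t - p) ≤ 0 ∧ DelaunayEdge P p t}
      (fun t => x t + y t)
      (by
        obtain ⟨a, ha⟩ := exists_neighbor_in_circumdisk hP hp hr hq hrq hpr hcr hcq hS
        exact ⟨a, Finset.mem_filter.2 ha⟩)
    obtain ⟨haP, hap, har, haq, hca, hpa⟩ := Finset.mem_filter.1 ha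
    have hya := coord_pos_of_circlePower_nonpos hq hqp hr_ne_q.symm hpr hcr hcq haP hap har hca
      (hxy a)
    have hxa := coord_pos_of_circlePower_nonpos hr hrp hr_ne_q hpq hcq hcr haP hap haq hca
      ((hxy a).trans (add_comm _ _))
    have hxya : 1 < x a + y a := by
      by_contra! hle
      exact hfree a haP hpa hap har haq _ _ hxa.le hya.le hle (hxy a)
    have hmin' : ∀ t ∈ P, DelaunayEdge P p t → t ≠ p → t ≠ r → t ≠ q →
        circlePower c (t - p) ≤ 0 → ∀ x' y' : ℝ, t - p = x' • (r - p) + y' • (q - p) →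
        x a + y a ≤ x' + y' := by
      intro t ht htn htp htr htq hct x' y' he
      obtain ⟨rfl, rfl⟩ := combination_injective hrq (he.symm.trans (hxy t))
      exact hmin t (Finset.mem_filter.2 ⟨ht, htp, htr, htq, hct, htn⟩)
    have hra : cross (r - p) (a - p) ≠ 0 := by
      rw [hxy a, cross_combination_right]; exact mul_ne_zero hya.ne' hrq
    have haq' : cross (a - p) (q - p) ≠ 0 := by
      rw [hxy a, cross_combination_left]; exact mul_ne_zero hxa.ne' hrq
    have hqr' : cross (q - p) (r - p) ≠ 0 := by rw [cross_comm]; exact neg_ne_zero.2 hrq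
    have hqa : cross (q - p) (a - p) ≠ 0 := by rw [cross_comm]; exact neg_ne_zero.2 haq'
    have hcone : a ∈ openCone p r q := ⟨_, _, hxa, hya, hxy a⟩
    have hf1 : NeighborFreeTriangle P p r a :=
      hfree.split hrq hcr hca (hxy a) hxa hya hxya hmin'
    have hf2 : NeighborFreeTriangle P p a q :=
      (hfree.symm.split hqr' hcq hca ((hxy a).trans (add_comm _ _)) hya hxa (by linarith)
        fun t ht htn htp htq htr hct x' y' he => by
          have := hmin' t ht htn htp htr htq hct y' x' (he.trans (add_comm _ _))
          linarith).symm
    have hlt1 := ncard_openCone_lt haP hra hcone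
    have hlt2 := ncard_openCone_lt haP hqa (openCone_comm p r q ▸ hcone)
    rw [openCone_comm p q a, openCone_comm p q r] at hlt2
    have hcirc : ‖a - p‖ ^ 2 ≤ x a * ‖r - p‖ ^ 2 + y a * ‖q - p‖ ^ 2 := by
      rw [circlePower, hxy a, inner_add_right, inner_smul_right, inner_smul_right, ← hxy a] at hca
      unfold circlePower at hcr hcq
      linear_combination hca - x a * hcr - y a * hcq
    have harc := arc_add_arc_le (hxy a) hxa hya hxya.le (sub_ne_zero.2 hrp) (sub_ne_zero.2 hqp)
      hcirc hsin
    simp only [sub_sub_sub_cancel_right, ← dist_eq_norm] at harc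
    exact ((ih _ (hn ▸ hlt1) hr haP hra hpr hpa hf1 rfl).trans
      (ih _ (hn ▸ hlt2) haP hq haq' hpa hpq hf2 rfl)).mono harc
  · push Not at hS
    refine .of_edge hr hq hpr hpq (delaunayEdge_of_circumdisk_empty_at hrq hcr hcq hS) ?_
    refine le_mul_of_one_le_left dist_nonneg ?_
    exact (one_le_div hsin).2 (Real.sin_le (InnerProductGeometry.angle_nonneg _ _))

/-- If r and q are Delaunay neighbours of p with α = ∠(r p q) < π/3 (r and q
in a cone of apex p of width π/3) and no point of P lies inside triangle (p,r,q), then there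
is a path from r to q in DT(P) using only edges between Delaunay neighbours of p, of total
length at most (α / sin α)·|rq|. -/
theorem short_canonical_path
    (P : Finset (EuclideanSpace ℝ (Fin 2)))
    (p r q : EuclideanSpace ℝ (Fin 2))
    (hp : p ∈ P) (hr : r ∈ P) (hq : q ∈ P)
    (hgp : GenPos P)
    (α : ℝ) (hα : α = ∠ r p q) (hα0 : 0 < α) (hα3 : α < π / 3)
    (hpr : DelaunayEdge P p r) (hpq : DelaunayEdge P p q)
    (hempty : ∀ t ∈ P, t ≠ p → t ≠ r → t ≠ q →
      t ∉ convexHull ℝ ({p, r, q} : Set (EuclideanSpace ℝ (Fin 2)))) :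
    ∃ (n : ℕ) (f : ℕ → EuclideanSpace ℝ (Fin 2)),
      f 0 = r ∧ f n = q ∧
      (∀ i ≤ n, f i ∈ P ∧ DelaunayEdge P p (f i)) ∧
      (∀ i < n, DelaunayEdge P (f i) (f (i + 1))) ∧
      (∑ i ∈ Finset.range n, dist (f i) (f (i + 1))) ≤ (α / Real.sin α) * dist r q := by
  have hsin : 0 < Real.sin (∠ r p q) :=
    Real.sin_pos_of_pos_of_lt_pi (hα ▸ hα0) (by rw [← hα]; linarith [Real.pi_pos])
  have hrp : r - p ≠ 0 := fun h => by
    rw [EuclideanGeometry.angle, vsub_eq_sub, h, InnerProductGeometry.angle_zero_left] at hα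
    linarith [Real.pi_pos]
  have hqp : q - p ≠ 0 := fun h => by
    rw [EuclideanGeometry.angle, vsub_eq_sub, vsub_eq_sub, h,
      InnerProductGeometry.angle_zero_right] at hα
    linarith [Real.pi_pos]
  rw [hα]
  refine hasCanonicalPath_of_neighborFree hgp hp hr hq
    (cross_ne_zero_of_sin_angle_ne_zero hsin.ne' hrp hqp) hpr hpq ?_
  intro t ht _ htp htr htq x y hx hy hxy he
  refine hempty t ht htp htr htq ?_
  have hcomb : t = (1 - x - y) • p + x • r + y • q := by
    rw [sub_eq_iff_eq_add.1 he]; module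
  have hmem := subset_convexHull ℝ ({p, r, q} : Set (EuclideanSpace ℝ (Fin 2)))
  rw [hcomb]
  refine (convex_convexHull ℝ _).sum_mem (t := Finset.univ) (w := ![1 - x - y, x, y])
    (z := ![p, r, q]) ?_ ?_ ?_ |> fun h => by simpa [Fin.sum_univ_three] using h
  · intro i _; fin_cases i <;> simp <;> linarith
  · simp [Fin.sum_univ_three]; ring
  · intro i _; fin_cases i <;> exact hmem (by simp)
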